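/- Let (X,d) be a finite metric space and ρ > 0. Let H₀ ⊆ X be a geodesic hub set for scale ρ/2, let W = {v ∈ X : d(v,y) > ρ/2 for all y ∈ H₀}, and let the clusters be the equivalence classes of W under the relation d(u,w) ≤ ρ/2. Suppose C* ⊆ X satisfies X = ⋃_{c ∈ C*} B(c,ρ), let C*₁ = C* \ W, let H ⊆ H₀ satisfy: for every c ∈ C*₁ there is x ∈ H with d(c,x) ≤ ρ/2, let R₁ = ⋃_{x ∈ H} B(x, 3ρ/2), and let 𝒰 be the set of clusters T with T ⊄ R₁. Then every cluster T ∈ 𝒰 contains a point of C* \ C*₁; since distinct clusters are disjoint, it follows that |𝒰| ≤ |C* \ C*₁|. -/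

import Mathlib

/-- A set `H` is a geodesic hub set for scale `r`: every pair of points at
distance in `(r, 2r]` has a point of `H` on a geodesic between them. -/
def IsGeodesicHubSet {X : Type*} [MetricSpace X] (H : Set X) (r : ℝ) : Prop :=
  ∀ u w : X, r < dist u w → dist u w ≤ 2 * r →
    ∃ x ∈ H, dist u x + dist x w = dist u w

/-- Two points farther than `r` from every hub are at distance at most `r` as soon as they are
at distance at most `2 * r`. -/
theorem IsGeodesicHubSet.dist_le_of_dist_le_two_mul {X : Type*} [MetricSpace X] {H : Set X}
    {r : ℝ} (hH : IsGeodesicHubSet H r) {u w : X} (hu : ∀ y ∈ H, r < dist u y)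
    (hw : ∀ y ∈ H, r < dist w y) (huw : dist u w ≤ 2 * r) : dist u w ≤ r := by
  by_contra! h
  obtain ⟨x, hx, hxuw⟩ := hH u w h huw
  have hux := hu x hx
  have hwx := hw x hx
  rw [dist_comm] at hwx
  linarith

theorem uncovered_clusters_contain_optimum_centers {X : Type*} [MetricSpace X] [Finite X]
    (ρ : ℝ) (hρ : 0 < ρ)
    (H₀ : Set X) (hH₀ : IsGeodesicHubSet H₀ (ρ / 2))
    (W : Set X) (hW : W = {v : X | ∀ y ∈ H₀, ρ / 2 < dist v y})
    -- the clusters: equivalence classes of `W` under the relation `dist u w ≤ ρ/2`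
    (𝒯 : Set (Set X)) (h𝒯 : 𝒯 = {T : Set X | ∃ v ∈ W, T = {u ∈ W | dist u v ≤ ρ / 2}})
    -- C* covers X with balls of radius ρ
    (Cstar : Set X) (hCstar : ∀ v : X, ∃ c ∈ Cstar, dist v c ≤ ρ)
    -- C*₁ is the set of non-cluster optimum centers; H ⊆ H₀ covers them at distance ρ/2
    (Cstar₁ : Set X) (hCstar₁ : Cstar₁ = Cstar \ W)
    (H : Set X) (hHsub : H ⊆ H₀)
    (hH : ∀ c ∈ Cstar₁, ∃ x ∈ H, dist c x ≤ ρ / 2)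
    -- R₁ is the region covered by balls of radius 3ρ/2 around H,
    -- and 𝒰 is the set of clusters not contained in R₁
    (R₁ : Set X) (hR₁ : R₁ = {v : X | ∃ x ∈ H, dist v x ≤ 3 * ρ / 2})
    (𝒰 : Set (Set X)) (h𝒰 : 𝒰 = {T ∈ 𝒯 | ¬ T ⊆ R₁}) :
    (∀ T ∈ 𝒰, ∃ c ∈ Cstar \ Cstar₁, c ∈ T) ∧
    𝒰.ncard ≤ (Cstar \ Cstar₁).ncard := by
  subst hW h𝒯 hCstar₁ hR₁ h𝒰
  set W : Set X := {v : X | ∀ y ∈ H₀, ρ / 2 < dist v y}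
  have close_trans {u v w : X} (hu : u ∈ W) (hw : w ∈ W) (huv : dist u v ≤ ρ / 2)
      (hvw : dist v w ≤ ρ / 2) : dist u w ≤ ρ / 2 :=
    hH₀.dist_le_of_dist_le_two_mul hu hw (by linarith [dist_triangle u v w])
  have exists_center : ∀ T ∈ {T ∈ {T : Set X | ∃ v ∈ W, T = {u ∈ W | dist u v ≤ ρ / 2}} |
      ¬ T ⊆ {v : X | ∃ x ∈ H, dist v x ≤ 3 * ρ / 2}},
      ∃ c ∈ Cstar \ (Cstar \ W), c ∈ T := by
    rintro _ ⟨⟨v, hv, rfl⟩, hT⟩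
    obtain ⟨t, ⟨ht, htv⟩, htR⟩ := Set.not_subset.1 hT
    obtain ⟨c, hc, htc⟩ := hCstar t
    have hcW : c ∈ W := by
      by_contra hcW
      obtain ⟨x, hx, hcx⟩ := hH c ⟨hc, hcW⟩
      exact htR ⟨x, hx, by linarith [dist_triangle t c x]⟩
    have hct : dist c t ≤ ρ / 2 :=
      hH₀.dist_le_of_dist_le_two_mul hcW ht (by rw [dist_comm]; linarith)
    exact ⟨c, ⟨hc, fun h => h.2 hcW⟩, hcW, close_trans hcW hv hct htv⟩
  have cluster_eq {v c : X} (hv : v ∈ W) (hc : c ∈ {u ∈ W | dist u v ≤ ρ / 2}) :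
      {u ∈ W | dist u v ≤ ρ / 2} = {u ∈ W | dist u c ≤ ρ / 2} := by
    ext u
    refine and_congr_right fun hu => ⟨fun h => ?_, fun h => close_trans hu hv h hc.2⟩
    exact close_trans hu hc.1 h (dist_comm c v ▸ hc.2)
  refine ⟨exists_center, ?_⟩
  choose f hf hfT using exists_center
  rw [← Nat.card_coe_set_eq, ← Nat.card_coe_set_eq]
  refine Nat.card_le_card_of_injective (fun T => ⟨f T T.2, hf T T.2⟩) ?_
  rintro ⟨T, hT⟩ ⟨T', hT'⟩ h
  have hcT := hfT T hT
  have hcT' := hfT T' hT'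
  rw [← Subtype.mk.inj h] at hcT'
  obtain ⟨⟨v, hv, hTv⟩, -⟩ := id hT
  obtain ⟨⟨v', hv', hTv'⟩, -⟩ := id hT'
  rw [Subtype.mk.injEq, hTv, hTv', cluster_eq hv (hTv.subset hcT),
    cluster_eq hv' (hTv'.subset hcT')]
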